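/- For every real x, the Hankel contour integral (i/(2π)) ∫_C e^{-z} (-z)^{-x} dz equals 1/Γ(x), where C is a contour starting at +∞ on the real axis, encircling the origin once counterclockwise, and returning to +∞. -/

import Mathlib

open Real Complex MeasureTheory

/-- The Hankel contour integral `(i/(2π)) ∫_C e^{-z} (-z)^{-x} dz`, where the
contour `C` starts at `+∞` (above the positive real axis, at height `δ`),
runs to `iδ`, encircles the origin once counterclockwise along the circle of
radius `δ` (from angle `π/2` to `3π/2`), and returns along the height `-δ`
to `+∞`. Here `(-z)^{-x}` is the principal branch, analytic off `[0,∞)`. -/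
noncomputable def hankelIntegral (x : ℝ) (δ : ℝ) : ℂ :=
  (Complex.I / (2 * Real.pi)) *
    (-(∫ t in Set.Ioi (0:ℝ), Complex.exp (-(↑t + ↑δ * Complex.I)) *
          (-(↑t + ↑δ * Complex.I)) ^ (-(x:ℂ)))
      + (∫ θ in (Real.pi / 2)..(3 * Real.pi / 2),
          Complex.exp (-(↑δ * Complex.exp (↑θ * Complex.I))) *
            (-(↑δ * Complex.exp (↑θ * Complex.I))) ^ (-(x:ℂ)) *
            (Complex.I * ↑δ * Complex.exp (↑θ * Complex.I)))
      + (∫ t in Set.Ioi (0:ℝ), Complex.exp (-(↑t - ↑δ * Complex.I)) *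
          (-(↑t - ↑δ * Complex.I)) ^ (-(x:ℂ))))


namespace Hankel
open Filter Topology Set

noncomputable def hk (x : ℝ) (w : ℂ) : ℂ := Complex.exp w * w ^ (-(x:ℂ))

noncomputable def K (δ : ℝ) (g : ℂ → ℂ) : ℂ :=
    (-(∫ t in Set.Ioi (0:ℝ), g (-(↑t + ↑δ * Complex.I)))
      + (∫ θ in (Real.pi / 2)..(3 * Real.pi / 2),
          g (-(↑δ * Complex.exp (↑θ * Complex.I))) *
            (Complex.I * ↑δ * Complex.exp (↑θ * Complex.I)))
      + (∫ t in Set.Ioi (0:ℝ), g (-(↑t - ↑δ * Complex.I))))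

lemma mem_ray {c : ℝ} (hc : c ≠ 0) (t : ℝ) : -((t:ℂ) + c * I) ∈ slitPlane := by
  right; simpa using hc

lemma mem_arc {δ : ℝ} (hδ : 0 < δ) {θ : ℝ} (h : θ ∈ Icc (π/2) (3*π/2)) :
    -((δ:ℂ) * exp (θ * I)) ∈ slitPlane := by
  by_cases h0 : Real.sin θ = 0
  · left
    have : Real.cos θ ≤ 0 := Real.cos_nonpos_of_pi_div_two_le_of_le h.1 (by linarith [h.2])
    have h1 : Real.cos θ ≠ 0 := by
      intro h2
      have := Real.sin_sq_add_cos_sq θ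
      rw [h0, h2] at this; norm_num at this
    have h3 : Real.cos θ < 0 := lt_of_le_of_ne this h1
    simp [Complex.exp_re]
    nlinarith
  · right
    simp [Complex.exp_im]
    exact ⟨hδ.ne', h0⟩

lemma pow_bound {δ : ℝ} (hδ : 0 < δ) (N : ℕ) (hN : 1 ≤ N) : ∃ C : ℝ, 0 ≤ C ∧ ∀ x : ℝ, |x| ≤ N →
    ∀ (w : ℂ) (t : ℝ), 0 ≤ t → δ ≤ ‖w‖ → ‖w‖ ≤ t + δ → ‖w ^ (-(x:ℂ))‖ ≤ C * Real.exp (t/2) := by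
  set m := min δ 1 with hm
  have hm0 : 0 < m := lt_min hδ one_pos
  have hm1 : m ≤ 1 := min_le_right _ _
  have hN' : (1:ℝ) ≤ N := by exact_mod_cast hN
  refine ⟨m ^ (-(N:ℝ)) * (m⁻¹ ^ N * (2*N)^N * Real.exp (δ/2)), by positivity, ?_⟩
  intro x hx w t ht h1 h2
  have e1 : ‖w ^ (-(x:ℂ))‖ = ‖w‖ ^ (-x) := by
    rw [← ofReal_neg, norm_cpow_real]
  have hw : 0 < ‖w‖ := lt_of_lt_of_le hδ h1
  have hwm : 1 ≤ ‖w‖ / m := by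
    rw [one_le_div hm0]; exact (min_le_left _ _).trans h1
  have e2 : ‖w‖ ^ (-x) = m ^ (-x) * (‖w‖ / m) ^ (-x) := by
    rw [← Real.mul_rpow hm0.le (by positivity)]; congr 1; field_simp
  have hx' := abs_le.mp hx
  have e3 : m ^ (-x) ≤ m ^ (-(N:ℝ)) :=
    Real.rpow_le_rpow_of_exponent_ge hm0 hm1 (by linarith)
  have e4 : (‖w‖ / m) ^ (-x) ≤ (‖w‖ / m) ^ N := by
    rw [← Real.rpow_natCast]
    exact Real.rpow_le_rpow_of_exponent_le hwm (by linarith)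
  have e5 : ‖w‖ ≤ 2 * N * Real.exp ((t+δ)/(2*N)) := by
    have := Real.add_one_le_exp ((t+δ)/(2*N))
    have h3 : (t+δ)/(2*N) ≤ Real.exp ((t+δ)/(2*N)) := by linarith
    rw [div_le_iff₀ (by positivity)] at h3
    linarith
  have e6 : (‖w‖ / m) ^ N ≤ m⁻¹ ^ N * (2*N)^N * Real.exp (δ/2) * Real.exp (t/2) := by
    have : (‖w‖ / m) ^ N ≤ (2 * N * Real.exp ((t+δ)/(2*N)) * m⁻¹) ^ N := by
      rw [div_eq_mul_inv]; gcongr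
    refine this.trans (le_of_eq ?_)
    rw [mul_pow, mul_pow, ← Real.exp_nat_mul, mul_assoc _ (Real.exp (δ/2)), ← Real.exp_add]
    have : (N:ℝ) * ((t+δ)/(2*N)) = δ/2 + t/2 := by field_simp; ring
    rw [this]; ring
  rw [e1, e2]
  calc m ^ (-x) * (‖w‖ / m) ^ (-x) ≤ m ^ (-(N:ℝ)) * (m⁻¹ ^ N * (2*N)^N * Real.exp (δ/2) * Real.exp (t/2)) := by
        gcongr; exact e4.trans e6
    _ = _ := by ring

lemma norm_ray {c t : ℝ} (ht : 0 ≤ t) : |c| ≤ ‖-((t:ℂ) + c * I)‖ ∧ ‖-((t:ℂ) + c * I)‖ ≤ t + |c| := by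
  constructor
  · simpa using abs_im_le_norm (-((t:ℂ) + c * I))
  · rw [norm_neg]
    refine (norm_add_le _ _).trans ?_
    simp [abs_of_nonneg ht]

lemma ray_bound {c : ℝ} (hc : c ≠ 0) (N : ℕ) (hN : 1 ≤ N) : ∃ C : ℝ, 0 ≤ C ∧ ∀ x : ℝ, |x| ≤ N →
    ∀ t : ℝ, 0 ≤ t → ‖hk x (-((t:ℂ) + c * I))‖ ≤ C * Real.exp (-(1/2) * t) := by
  obtain ⟨C, hC, h⟩ := pow_bound (abs_pos.mpr hc) N hN
  refine ⟨C, hC, fun x hx t ht => ?_⟩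
  have := h x hx _ t ht (norm_ray (c := c) ht).1 (norm_ray ht).2
  rw [hk, norm_mul, norm_exp]
  have e : (-((t:ℂ) + c * I)).re = -t := by simp
  rw [e]
  calc _ ≤ Real.exp (-t) * (C * Real.exp (t/2)) := by gcongr
    _ = C * (Real.exp (-t) * Real.exp (t/2)) := by ring
    _ = _ := by rw [← Real.exp_add]; ring_nf

lemma hk_contAt (x : ℝ) {w : ℂ} (hw : w ∈ slitPlane) : ContinuousAt (hk x) w := by
  unfold hk
  exact continuous_exp.continuousAt.mul (continuousAt_cpow_const hw)

lemma hk_ray_cont (x : ℝ) {c : ℝ} (hc : c ≠ 0) :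
    Continuous (fun t : ℝ => hk x (-((t:ℂ) + c * I))) := by
  rw [continuous_iff_continuousAt]
  intro t
  exact ContinuousAt.comp (f := fun t : ℝ => -((t:ℂ) + c * I)) (hk_contAt x (mem_ray hc t))
    (by fun_prop)

lemma hk_arc_cont (x : ℝ) {δ : ℝ} (hδ : 0 < δ) :
    ContinuousOn (fun θ : ℝ => hk x (-((δ:ℂ) * exp (θ * I))) * (I * δ * exp (θ * I)))
      (Icc (π/2) (3*π/2)) := by
  intro t ht
  refine ContinuousAt.continuousWithinAt (ContinuousAt.mul ?_ (by fun_prop))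
  exact ContinuousAt.comp (f := fun θ : ℝ => -((δ:ℂ) * exp (θ * I))) (hk_contAt x (mem_arc hδ ht))
    (by fun_prop)

lemma hk_ray_int (x : ℝ) {c : ℝ} (hc : c ≠ 0) :
    IntegrableOn (fun t : ℝ => hk x (-((t:ℂ) + c * I))) (Ioi 0) := by
  obtain ⟨N, hN⟩ := exists_nat_ge |x|
  obtain ⟨C, hC, h⟩ := ray_bound hc (N+1) (by omega)
  have hi : IntegrableOn (fun t : ℝ => C * Real.exp (-(1/2) * t)) (Ioi 0) :=
    (exp_neg_integrableOn_Ioi 0 (by norm_num : (0:ℝ) < 1/2)).const_mul C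
  refine Integrable.mono' hi (hk_ray_cont x hc).aestronglyMeasurable ?_
  filter_upwards [ae_restrict_mem measurableSet_Ioi] with t ht
  exact h x (by push_cast; linarith) t (le_of_lt ht)

lemma hk_ray_tendsto (x : ℝ) {c : ℝ} (hc : c ≠ 0) :
    Tendsto (fun t : ℝ => hk x (-((t:ℂ) + c * I))) atTop (𝓝 0) := by
  obtain ⟨N, hN⟩ := exists_nat_ge |x|
  obtain ⟨C, hC, h⟩ := ray_bound hc (N+1) (by omega)
  have hi : Tendsto (fun t : ℝ => C * Real.exp (-(1/2) * t)) atTop (𝓝 0) := by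
    rw [← mul_zero C]
    refine Tendsto.const_mul _ (Real.tendsto_exp_atBot.comp ?_)
    exact tendsto_id.const_mul_atTop_of_neg (by norm_num)
  refine squeeze_zero_norm' ?_ hi
  filter_upwards [eventually_ge_atTop 0] with t ht
  exact h x (by push_cast; linarith) t ht

lemma arc_le : π/2 ≤ 3*π/2 := by linarith [pi_pos]

lemma hk_arc_int (x : ℝ) {δ : ℝ} (hδ : 0 < δ) :
    IntervalIntegrable (fun θ : ℝ => hk x (-((δ:ℂ) * exp (θ * I))) * (I * δ * exp (θ * I)))
      volume (π/2) (3*π/2) :=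
  ContinuousOn.intervalIntegrable (by rw [uIcc_of_le arc_le]; exact hk_arc_cont x hδ)

lemma sub_eq (δ t : ℝ) : (t:ℂ) - δ * I = t + ((-δ : ℝ) : ℂ) * I := by push_cast; ring

lemma K_ftc {δ : ℝ} (hδ : 0 < δ) (g G : ℂ → ℂ) (hG : ∀ w ∈ slitPlane, HasDerivAt G (g w) w)
    (L : ℝ → ℂ)
    (hi : ∀ c : ℝ, c ≠ 0 → IntegrableOn (fun t : ℝ => g (-((t:ℂ) + c * I))) (Ioi 0))
    (ha : IntervalIntegrable (fun θ : ℝ => g (-((δ:ℂ) * exp (θ * I))) * (I * δ * exp (θ * I)))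
      volume (π/2) (3*π/2))
    (hL : ∀ c : ℝ, c ≠ 0 → Tendsto (fun t : ℝ => G (-((t:ℂ) + c * I))) atTop (𝓝 (L c))) :
    K δ g = L δ - L (-δ) := by
  have ray : ∀ c : ℝ, c ≠ 0 → ∫ t in Ioi (0:ℝ), g (-((t:ℂ) + c * I)) = G (-(c * I)) - L c := by
    intro c hc
    have := integral_Ioi_of_hasDerivAt_of_tendsto' (a := 0) (m := - L c)
      (f := fun t : ℝ => - G (-((t:ℂ) + c * I))) (f' := fun t : ℝ => g (-((t:ℂ) + c * I)))
      (by
        intro t _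
        have h1 : HasDerivAt (fun t : ℝ => -((t:ℂ) + c * I)) (-1) t :=
          ((hasDerivAt_id t).ofReal_comp.add_const _).neg
        have := ((hG _ (mem_ray hc t)).comp t h1).neg
        exact HasDerivAt.congr_deriv this (by ring)) (hi c hc) (hL c hc).neg
    rw [this]; simp; ring
  have arc : ∫ θ in (π/2)..(3*π/2), g (-((δ:ℂ) * exp (θ * I))) * (I * δ * exp (θ * I))
      = G (-(δ * I)) - G (δ * I) := by
    have := intervalIntegral.integral_eq_sub_of_hasDerivAt (a := π/2) (b := 3*π/2)
      (f := fun θ : ℝ => - G (-((δ:ℂ) * exp (θ * I))))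
      (f' := fun θ : ℝ => g (-((δ:ℂ) * exp (θ * I))) * (I * δ * exp (θ * I)))
      (by
        intro t ht
        rw [uIcc_of_le arc_le] at ht
        have h1 : HasDerivAt (fun t : ℝ => -((δ:ℂ) * exp (t * I))) (-(δ * (exp (t * I) * (1 * I)))) t :=
          ((((hasDerivAt_id t).ofReal_comp.mul_const I).cexp).const_mul _).neg
        have := ((hG _ (mem_arc hδ ht)).comp t h1).neg
        exact HasDerivAt.congr_deriv this (by ring)) ha
    rw [this]
    have e1 : exp (((π/2:ℝ):ℂ) * I) = I := by push_cast; exact exp_pi_div_two_mul_I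
    have e2 : exp (((3*π/2:ℝ):ℂ) * I) = -I := by
      have : ((3*π/2:ℝ):ℂ) * I = π * I + π/2 * I := by push_cast; ring
      rw [this, Complex.exp_add, exp_pi_mul_I, exp_pi_div_two_mul_I]; ring
    rw [e1, e2]; simp; ring
  unfold K
  simp_rw [sub_eq]
  rw [ray δ hδ.ne', ray (-δ) (by simpa using hδ.ne'), arc]
  simp

lemma K_rec {δ : ℝ} (hδ : 0 < δ) (x : ℝ) : K δ (hk x) = x * K δ (hk (x+1)) := by
  have h := K_ftc hδ (fun w => hk x w - x * hk (x+1) w) (hk x) (by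
    intro w hw
    have := (Complex.hasDerivAt_exp w).mul ((hasDerivAt_id w).cpow_const (c := -(x:ℂ)) hw)
    refine HasDerivAt.congr_deriv (f := hk x) this ?_
    simp only [hk, id]
    have : -((x+1:ℝ):ℂ) = -(x:ℂ) - 1 := by push_cast; ring
    rw [this]; ring) (fun _ => 0)
    (fun c hc => (hk_ray_int x hc).sub ((hk_ray_int (x+1) hc).const_mul _))
    (by
      have := (hk_arc_int x hδ).sub ((hk_arc_int (x+1) hδ).const_mul (x:ℂ))
      convert this using 2
      ring) (fun c hc => hk_ray_tendsto x hc)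
  rw [sub_self] at h
  rw [← sub_eq_zero, ← h]
  have hδ' : -δ ≠ 0 := by simpa using hδ.ne'
  unfold K
  simp_rw [sub_eq, sub_mul, mul_assoc (x:ℂ)]
  rw [integral_sub (hk_ray_int x hδ.ne') ((hk_ray_int (x+1) hδ.ne').const_mul _),
    integral_sub (hk_ray_int x hδ') ((hk_ray_int (x+1) hδ').const_mul _),
    intervalIntegral.integral_sub (hk_arc_int x hδ) ((hk_arc_int (x+1) hδ).const_mul _)]
  rw [integral_const_mul, integral_const_mul, intervalIntegral.integral_const_mul]
  ring

lemma hk_cont_x (w : ℂ) (hw : w ≠ 0) : Continuous (fun x : ℝ => hk x w) := by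
  unfold hk
  refine continuous_const.mul ?_
  exact Continuous.const_cpow (by fun_prop) (Or.inl hw)

lemma K_cont {δ : ℝ} (hδ : 0 < δ) : ContinuousAt (fun x => K δ (hk x)) 1 := by
  have hev : ∀ᶠ x : ℝ in 𝓝 1, |x| ≤ (2:ℕ) := by
    have : ∀ᶠ x : ℝ in 𝓝 1, |x| < 2 := continuous_abs.continuousAt.eventually_lt_const (by norm_num)
    filter_upwards [this] with x hx
    exact_mod_cast hx.le
  have ray : ∀ c : ℝ, c ≠ 0 →
      ContinuousAt (fun x => ∫ t in Ioi (0:ℝ), hk x (-((t:ℂ) + c * I))) 1 := by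
    intro c hc
    obtain ⟨C, hC, h⟩ := ray_bound hc 2 (by norm_num)
    refine continuousAt_of_dominated (bound := fun t : ℝ => C * Real.exp (-(1/2) * t)) ?_ ?_ ?_ ?_
    · exact Eventually.of_forall fun x => (hk_ray_cont x hc).aestronglyMeasurable
    · filter_upwards [hev] with x hx
      filter_upwards [ae_restrict_mem measurableSet_Ioi] with t ht
      exact h x hx t (le_of_lt ht)
    · exact (exp_neg_integrableOn_Ioi 0 (by norm_num : (0:ℝ) < 1/2)).const_mul C
    · exact Eventually.of_forall fun t =>
        (hk_cont_x _ (slitPlane_ne_zero (mem_ray hc t))).continuousAt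
  have arc : ContinuousAt (fun x => ∫ θ in (π/2)..(3*π/2),
      hk x (-((δ:ℂ) * exp (θ * I))) * (I * δ * exp (θ * I))) 1 := by
    obtain ⟨C, hC, h⟩ := pow_bound hδ 2 (by norm_num)
    refine intervalIntegral.continuousAt_of_dominated_interval
      (bound := fun _ : ℝ => Real.exp δ * C * δ) ?_ ?_ (by simp) ?_
    · exact Eventually.of_forall fun x => (hk_arc_int x hδ).aestronglyMeasurable_restrict_uIoc
    · filter_upwards [hev] with x hx
      refine Eventually.of_forall fun θ _ => ?_
      have hn : ‖-((δ:ℂ) * exp (θ * I))‖ = δ := by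
        simp [Complex.norm_exp_ofReal_mul_I, abs_of_pos hδ]
      have := h x hx (-((δ:ℂ) * exp (θ * I))) 0 le_rfl hn.ge (by rw [hn]; linarith)
      have h2 : ‖I * δ * exp (θ * I)‖ = δ := by
        simp [Complex.norm_exp_ofReal_mul_I, abs_of_pos hδ]
      rw [norm_mul, h2, hk, norm_mul]
      have h3 : ‖exp (-((δ:ℂ) * exp (θ * I)))‖ ≤ Real.exp δ := by
        rw [norm_exp]
        exact Real.exp_le_exp.mpr ((re_le_norm _).trans hn.le)
      gcongr
      simpa using this
    · refine Eventually.of_forall fun θ _ => ?_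
      refine ContinuousAt.mul (hk_cont_x _ ?_).continuousAt continuousAt_const
      simp [hδ.ne']
  unfold K
  simp_rw [sub_eq]
  exact ((ray δ hδ.ne').neg.add arc).add (ray (-δ) (by simpa using hδ.ne'))

noncomputable def g (p : ℝ) (w : ℂ) : ℂ := ∫ s in (0:ℝ)..1, ((s^p : ℝ) : ℂ) * exp (s * w)

lemma g_deriv {p : ℝ} (hp : 0 < p) (w : ℂ) :
    HasDerivAt (g p) (∫ s in (0:ℝ)..1, ((s^p : ℝ) : ℂ) * (exp (s * w) * s)) w := by
  have cs : Continuous (fun s : ℝ => ((s^p : ℝ) : ℂ)) :=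
    continuous_ofReal.comp (Real.continuous_rpow_const hp.le)
  have c1 : ∀ w : ℂ, Continuous (fun s : ℝ => ((s^p : ℝ) : ℂ) * exp (s * w)) := fun w =>
    cs.mul (by fun_prop)
  have c2 : ∀ w : ℂ, Continuous (fun s : ℝ => ((s^p : ℝ) : ℂ) * (exp (s * w) * s)) := fun w =>
    cs.mul (by fun_prop)
  refine (intervalIntegral.hasDerivAt_integral_of_dominated_loc_of_deriv_le
    (s := Metric.ball w 1) (F := fun (w:ℂ) (s:ℝ) => ((s^p : ℝ) : ℂ) * exp (s * w)) (bound := fun _ => Real.exp (‖w‖ + 1))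
    (F' := fun (w:ℂ) (s:ℝ) => ((s^p : ℝ) : ℂ) * (exp (s * w) * s))
    (Metric.ball_mem_nhds w one_pos) ?_ ?_ ?_ ?_ (by simp) ?_).2
  · exact Eventually.of_forall fun w => (c1 w).aestronglyMeasurable
  · exact (c1 w).intervalIntegrable _ _
  · exact (c2 w).aestronglyMeasurable
  · refine Eventually.of_forall fun s hs v hv => ?_
    rw [uIoc_of_le zero_le_one] at hs
    have hv' : ‖v‖ ≤ ‖w‖ + 1 := by
      have : ‖v - w‖ < 1 := by simpa [dist_eq_norm] using hv
      have h2 := norm_add_le (v - w) w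
      simp at h2; linarith
    have h1 : ‖((s^p : ℝ) : ℂ)‖ ≤ 1 := by
      rw [norm_real, Real.norm_of_nonneg (Real.rpow_nonneg hs.1.le _)]
      exact Real.rpow_le_one hs.1.le hs.2 hp.le
    have h2 : ‖(s:ℂ)‖ ≤ 1 := by
      rw [norm_real, Real.norm_of_nonneg hs.1.le]; exact hs.2
    have h3 : ‖exp (s * v)‖ ≤ Real.exp (‖w‖ + 1) := by
      rw [norm_exp]
      refine Real.exp_le_exp.mpr ((re_le_norm _).trans ?_)
      rw [norm_mul]
      calc _ ≤ 1 * ‖v‖ := by gcongr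
        _ ≤ _ := by linarith
    rw [norm_mul, norm_mul]
    calc _ ≤ 1 * (Real.exp (‖w‖+1) * 1) := by gcongr
      _ = _ := by ring
  · refine Eventually.of_forall fun s _ v _ => ?_
    have := (((hasDerivAt_id v).const_mul (s:ℂ)).cexp).const_mul ((s^p : ℝ) : ℂ)
    simpa using this

lemma g_parts {p : ℝ} (hp : 0 < p) (w : ℂ) :
    (p + 1) * g p w + w * (∫ s in (0:ℝ)..1, ((s^p : ℝ) : ℂ) * (exp (s * w) * s)) = exp w := by
  have cs : Continuous (fun s : ℝ => ((s^p : ℝ) : ℂ)) :=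
    continuous_ofReal.comp (Real.continuous_rpow_const hp.le)
  have c1 : Continuous (fun s : ℝ => ((s^p : ℝ) : ℂ) * exp (s * w)) := 
    cs.mul (by fun_prop)
  have c2 : Continuous (fun s : ℝ => ((s^p : ℝ) : ℂ) * (exp (s * w) * s)) := 
    cs.mul (by fun_prop)
  unfold g
  rw [← intervalIntegral.integral_const_mul, ← intervalIntegral.integral_const_mul,
    ← intervalIntegral.integral_add ((c1.const_mul _).intervalIntegrable _ _)
     ((c2.const_mul _).intervalIntegrable _ _)]
  rw [intervalIntegral.integral_eq_sub_of_hasDerivAt (f := fun s : ℝ => ((s^(p+1) : ℝ) : ℂ) * exp (s * w))]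
  · simp [Real.zero_rpow (by linarith : p + 1 ≠ 0)]
  · intro s hs
    rw [uIcc_of_le zero_le_one] at hs
    have h1 := (Real.hasDerivAt_rpow_const (x := s) (p := p+1) (Or.inr (by linarith))).ofReal_comp
    have h2 := ((hasDerivAt_id s).ofReal_comp.mul_const w).cexp
    refine HasDerivAt.congr_deriv (h1.mul h2) ?_
    have : s^(p+1) = s^p * s := by
      rw [Real.rpow_add_one' hs.1 (by linarith)]
    simp only [this]
    simp
    ring
  · exact ((c1.const_mul _).add (c2.const_mul _)).intervalIntegrable _ _

lemma F_deriv {p : ℝ} (hp : 0 < p) {w : ℂ} (hw : w ∈ slitPlane) :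
    HasDerivAt (fun w => w ^ ((p:ℂ)+1) * g p w) (hk (-p) w) w := by
  have := ((hasDerivAt_id w).cpow_const (c := (p:ℂ)+1) hw).mul (g_deriv hp w)
  refine HasDerivAt.congr_deriv this ?_
  simp only [hk, id, ← g_parts hp w]
  have h0 := slitPlane_ne_zero hw
  have e : w ^ ((p:ℂ)+1) = w ^ (p:ℂ) * w := by rw [cpow_add _ _ h0, cpow_one]
  rw [e]
  simp
  ring

lemma scaled {p : ℝ} (hp : 0 < p) (c t : ℝ) (ht : 0 < t) :
    ((t^(p+1) : ℝ) : ℂ) * g p (-((t:ℂ) + c * I)) =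
      ∫ u in Ioi (0:ℝ), (Iic t).indicator
        (fun u : ℝ => ((u^p : ℝ):ℂ) * exp (-u - (u / t * c : ℝ) * I)) u := by
  rw [setIntegral_indicator measurableSet_Iic, Ioi_inter_Iic,
    ← intervalIntegral.integral_of_le ht.le]
  have := intervalIntegral.smul_integral_comp_mul_left (a := 0) (b := 1)
    (fun u : ℝ => ((u^p : ℝ):ℂ) * exp (-u - (u / t * c : ℝ) * I)) t
  rw [mul_zero, mul_one] at this
  rw [← this, g, Real.rpow_add_one ht.ne', ofReal_mul, mul_comm ((t^p:ℝ):ℂ), mul_assoc, real_smul,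
    ← intervalIntegral.integral_const_mul]
  congr 1
  refine intervalIntegral.integral_congr fun s hs => ?_
  rw [uIcc_of_le zero_le_one] at hs
  beta_reduce
  rw [Real.mul_rpow ht.le hs.1, ofReal_mul, ← mul_assoc]
  congr 2
  have : t * s / t * c = s * c := by field_simp
  rw [this]; push_cast; ring

lemma scaled_tendsto {p : ℝ} (hp : 0 < p) (c : ℝ) :
    Tendsto (fun t : ℝ => ((t^(p+1) : ℝ) : ℂ) * g p (-((t:ℂ) + c * I))) atTop
      (𝓝 (Real.Gamma (p+1) : ℝ)) := by
  have e : ((Real.Gamma (p+1) : ℝ) : ℂ) = ∫ u in Ioi (0:ℝ), ((u^p : ℝ):ℂ) * exp (-(u:ℂ)) := by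
    rw [Real.Gamma_eq_integral (by linarith), ← integral_complex_ofReal]
    refine setIntegral_congr_fun measurableSet_Ioi fun u _ => ?_
    simp
    ring
  rw [e]
  have key : Tendsto (fun t : ℝ => ∫ u in Ioi (0:ℝ), (Iic t).indicator
        (fun u : ℝ => ((u^p : ℝ):ℂ) * exp (-u - (u / t * c : ℝ) * I)) u) atTop
        (𝓝 (∫ u in Ioi (0:ℝ), ((u^p : ℝ):ℂ) * exp (-(u:ℂ)))) := by
    have cs : Continuous (fun s : ℝ => ((s^p : ℝ) : ℂ)) :=
      continuous_ofReal.comp (Real.continuous_rpow_const hp.le)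
    refine tendsto_integral_filter_of_dominated_convergence
      (fun u => Real.exp (-u) * u ^ ((p + 1) - 1)) ?_ ?_ (Real.GammaIntegral_convergent (by linarith)) ?_
    · refine Eventually.of_forall fun t => ?_
      refine AEStronglyMeasurable.indicator ?_ measurableSet_Iic
      exact (cs.mul (by fun_prop)).aestronglyMeasurable
    · refine Eventually.of_forall fun t => ?_
      filter_upwards [ae_restrict_mem measurableSet_Ioi] with u hu
      refine (norm_indicator_le_norm_self _ _).trans (le_of_eq ?_)
      rw [norm_mul, norm_real, Real.norm_of_nonneg (Real.rpow_nonneg (le_of_lt hu) _), norm_exp]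
      have : (-(u:ℂ) - (u / t * c : ℝ) * I).re = -u := by
        simp only [sub_re, neg_re, ofReal_re, re_ofReal_mul, I_re]; ring
      rw [this]; simp [mul_comm]
    · refine Eventually.of_forall fun u => ?_
      have h1 : Tendsto (fun t : ℝ => ((u^p : ℝ):ℂ) * exp (-u - (u / t * c : ℝ) * I)) atTop
          (𝓝 (((u^p : ℝ):ℂ) * exp (-u - ((0 * c : ℝ):ℂ) * I))) := by
        have h0 : Tendsto (fun t : ℝ => u / t * c) atTop (𝓝 (0 * c)) :=
          (tendsto_const_nhds.div_atTop tendsto_id).mul_const c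
        have hc : Continuous (fun r : ℝ => ((u^p : ℝ):ℂ) * exp (-u - (r:ℂ) * I)) := by fun_prop
        exact (hc.tendsto _).comp h0
      simp only [zero_mul, ofReal_zero, sub_zero] at h1
      refine h1.congr' ?_
      filter_upwards [eventually_ge_atTop u] with t ht
      rw [indicator_of_mem (by exact ht)]
  refine key.congr' ?_
  filter_upwards [eventually_gt_atTop 0] with t ht
  exact (scaled hp c t ht).symm

noncomputable def sg (c : ℝ) : ℝ := if 0 < c then -1 else 1

lemma log_tendsto {c : ℝ} (hc : c ≠ 0) :
    Tendsto (fun t : ℝ => log (-(1 + ((c / t : ℝ):ℂ) * I))) atTop (𝓝 (sg c * (π * I))) := by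
  have h0 : Tendsto (fun t : ℝ => c / t) atTop (𝓝 0) :=
    tendsto_const_nhds.div_atTop tendsto_id
  have h1 : Tendsto (fun t : ℝ => -(1 + ((c / t : ℝ):ℂ) * I)) atTop (𝓝 (-1)) := by
    have hc : Continuous (fun r : ℝ => -(1 + (r:ℂ) * I)) := by fun_prop
    have := (hc.tendsto 0).comp h0
    simpa [Function.comp_def] using this
  rcases lt_or_gt_of_ne hc with h | h
  · have hl := tendsto_log_nhdsWithin_im_nonneg_of_re_neg_of_im_zero (z := -1) (by simp) (by simp)
    have : Tendsto (fun t : ℝ => -(1 + ((c / t : ℝ):ℂ) * I)) atTop (𝓝[{z : ℂ | 0 ≤ z.im}] (-1)) := by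
      refine tendsto_nhdsWithin_iff.mpr ⟨h1, ?_⟩
      filter_upwards [eventually_gt_atTop 0] with t ht
      have : c / t ≤ 0 := (div_neg_of_neg_of_pos h ht).le
      simp only [mem_ofPred_eq, neg_im, add_im, one_im, im_ofReal_mul, I_im]
      linarith
    have := hl.comp this
    simpa [sg, not_lt.mpr h.le, Function.comp_def] using this
  · have hl := tendsto_log_nhdsWithin_im_neg_of_re_neg_of_im_zero (z := -1) (by simp) (by simp)
    have : Tendsto (fun t : ℝ => -(1 + ((c / t : ℝ):ℂ) * I)) atTop (𝓝[{z : ℂ | z.im < 0}] (-1)) := by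
      refine tendsto_nhdsWithin_iff.mpr ⟨h1, ?_⟩
      filter_upwards [eventually_gt_atTop 0] with t ht
      have : 0 < c / t := div_pos h ht
      simp only [mem_ofPred_eq, neg_im, add_im, one_im, im_ofReal_mul, I_im]
      linarith
    have := hl.comp this
    simpa [sg, h, Function.comp_def] using this

lemma F_tendsto {p : ℝ} (hp : 0 < p) {c : ℝ} (hc : c ≠ 0) :
    Tendsto (fun t : ℝ => (-((t:ℂ) + c * I)) ^ ((p:ℂ)+1) * g p (-((t:ℂ) + c * I))) atTop
      (𝓝 (exp (sg c * (π * I) * (p+1)) * (Real.Gamma (p+1) : ℝ))) := by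
  have h := (((Complex.continuous_exp.tendsto _).comp ((log_tendsto hc).mul_const ((p:ℂ)+1)))).mul
    (scaled_tendsto hp c)
  refine h.congr' ?_
  filter_upwards [eventually_gt_atTop 0] with t ht
  have h1 : -((t:ℂ) + c * I) = t * (-(1 + ((c / t : ℝ):ℂ) * I)) := by
    have : (t:ℂ) ≠ 0 := by exact_mod_cast ht.ne'
    push_cast; field_simp
  have h2 : -(1 + ((c / t : ℝ):ℂ) * I) ≠ 0 := by
    intro h
    have := congrArg im h
    simp only [neg_im, add_im, one_im, im_ofReal_mul, I_im, zero_im] at this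
    have h3 : c / t ≠ 0 := div_ne_zero hc ht.ne'
    apply h3; linarith
  have h4 : (-((t:ℂ) + c * I)) ^ ((p:ℂ)+1) =
      exp (log (-(1 + ((c / t : ℝ):ℂ) * I)) * (p+1)) * ((t^(p+1) : ℝ) : ℂ) := by
    rw [cpow_def_of_ne_zero (slitPlane_ne_zero (mem_ray hc t)), h1, log_ofReal_mul ht h2,
      Real.rpow_def_of_pos ht, ofReal_exp, ← Complex.exp_add]
    congr 1
    push_cast; ring
  rw [h4]
  simp only [Function.comp_def]
  ring

lemma base {δ : ℝ} (hδ : 0 < δ) {x : ℝ} (hx : x < 0) :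
    I / (2 * π) * K δ (hk x) = (1 / Real.Gamma x : ℝ) := by
  obtain ⟨p, rfl⟩ : ∃ p, x = -p := ⟨-x, by ring⟩
  have hp : 0 < p := by linarith
  rw [K_ftc hδ (hk (-p)) _ (fun w hw => F_deriv hp hw) _ (fun c hc => hk_ray_int _ hc)
    (hk_arc_int _ hδ) (fun c hc => F_tendsto hp hc)]
  have s1 : sg δ = -1 := by simp [sg, hδ]
  have s2 : sg (-δ) = 1 := by simp [sg, hδ.le]
  rw [s1, s2]
  have hr := Real.Gamma_mul_Gamma_one_sub (-p)
  rw [sub_neg_eq_add, add_comm 1 p] at hr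
  have hG : Real.Gamma (p+1) ≠ 0 := (Real.Gamma_pos_of_pos (by linarith)).ne'
  have h1 : 1 / Real.Gamma (-p) = - Real.Gamma (p+1) * Real.sin (π * p) / π := by
    have : Real.Gamma (-p) = (π / Real.sin (π * -p)) / Real.Gamma (p+1) := by
      rw [← hr]; field_simp
    rw [this, mul_neg, Real.sin_neg, one_div_div, div_neg, div_neg, div_div_eq_mul_div]
    ring
  rw [h1]
  have h2 : exp (((-1:ℝ):ℂ) * (π * I) * (p+1)) = - (Real.cos (π*p) - Real.sin (π * p) * I) := by
    have : ((-1:ℝ):ℂ) * (π * I) * (p+1) = ((-(π * p) : ℝ):ℂ) * I + -(π * I) := by push_cast; ring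
    rw [this, Complex.exp_add, exp_mul_I, Complex.exp_neg, exp_pi_mul_I, ← ofReal_cos, ← ofReal_sin,
      Real.cos_neg, Real.sin_neg]
    push_cast; ring
  have h3 : exp (((1:ℝ):ℂ) * (π * I) * (p+1)) = - (Real.cos (π*p) + Real.sin (π * p) * I) := by
    have : ((1:ℝ):ℂ) * (π * I) * (p+1) = ((π * p : ℝ):ℂ) * I + (π * I) := by push_cast; ring
    rw [this, Complex.exp_add, exp_mul_I, exp_pi_mul_I, ← ofReal_cos, ← ofReal_sin]
    ring
  rw [h2, h3]
  have hpi : (π:ℂ) ≠ 0 := by exact_mod_cast pi_ne_zero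
  rw [ofReal_div, ofReal_mul, ofReal_neg]
  field_simp
  ring_nf
  rw [I_sq]; ring

lemma step {δ : ℝ} (hδ : 0 < δ) {x : ℝ} (hx : x ≠ 0)
    (h : I / (2 * π) * K δ (hk x) = (1 / Real.Gamma x : ℝ)) :
    I / (2 * π) * K δ (hk (x+1)) = (1 / Real.Gamma (x+1) : ℝ) := by
  have hx' : (x:ℂ) ≠ 0 := by exact_mod_cast hx
  rw [K_rec hδ x] at h
  rw [Real.Gamma_add_one hx, mul_comm x, ← div_div 1, ofReal_div (1 / Real.Gamma x), ← h]
  field_simp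

lemma lt_one {δ : ℝ} (hδ : 0 < δ) {x : ℝ} (hx : x < 1) :
    I / (2 * π) * K δ (hk x) = (1 / Real.Gamma x : ℝ) := by
  have := step hδ (x := x - 1) (by linarith) (base hδ (by linarith))
  simpa using this

lemma eq_one {δ : ℝ} (hδ : 0 < δ) :
    I / (2 * π) * K δ (hk 1) = (1 / Real.Gamma 1 : ℝ) := by
  have c1 : Tendsto (fun x => I / (2 * π) * K δ (hk x)) (𝓝[<] 1) (𝓝 (I / (2 * π) * K δ (hk 1))) :=
    ((K_cont hδ).const_mul _).tendsto.mono_left nhdsWithin_le_nhds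
  have c2 : Tendsto (fun x : ℝ => ((1 / Real.Gamma x : ℝ) : ℂ)) (𝓝[<] 1)
      (𝓝 ((1 / Real.Gamma 1 : ℝ) : ℂ)) := by
    have h1 : ContinuousAt Real.Gamma 1 := by
      refine (Real.differentiableAt_Gamma fun m => ?_).continuousAt
      have : (0:ℝ) ≤ m := Nat.cast_nonneg m
      linarith
    have h2 : ContinuousAt (fun x : ℝ => 1 / Real.Gamma x) 1 :=
      continuousAt_const.div h1 (by simp)
    exact ((continuous_ofReal.tendsto _).comp h2.tendsto).mono_left nhdsWithin_le_nhds
  refine tendsto_nhds_unique c1 (c2.congr' ?_)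
  filter_upwards [self_mem_nhdsWithin] with x hx
  exact (lt_one hδ hx).symm

lemma all {δ : ℝ} (hδ : 0 < δ) (n : ℕ) : ∀ x : ℝ, x ≤ n + 1 →
    I / (2 * π) * K δ (hk x) = (1 / Real.Gamma x : ℝ) := by
  induction n with
  | zero =>
    intro x hx
    rcases lt_or_eq_of_le hx with h | h
    · exact lt_one hδ (by simpa using h)
    · have : x = 1 := by simpa using h
      rw [this]; exact eq_one hδ
  | succ n ih =>
    intro x hx
    by_cases h : x ≤ 1
    · exact ih x (by have : (0:ℝ) ≤ n := Nat.cast_nonneg n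
                     linarith)
    · have := step hδ (x := x - 1) (by intro h'; apply h; linarith)
        (ih (x-1) (by push_cast at hx; linarith))
      simpa using this

end Hankel

theorem stmt_18 (x : ℝ) (δ : ℝ) (hδ : 0 < δ) :
    hankelIntegral x δ = (1 / Real.Gamma x : ℝ) := by
  obtain ⟨n, hn⟩ := exists_nat_ge x
  have := Hankel.all hδ n x (by linarith)
  rw [← this]
  rfl
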